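/- arXiv:2506.10775 — 2 statements merged into one kernel-verified Lean document; each statement's English description precedes it below -/
import Mathlib

section
/- There is a universal constant C such that the following holds. Let P be a finite multiset of n labeled points in ℝ^d with width w. When the RPE algorithm is run on P, the expected number of elements it probes (equivalently, the expected size of the output set Z) is at most C · w · log₂(1 + n/w). -/
open scoped Classical ENNReal

noncomputable section

/-- `p` dominates `q`: `p ≠ q` and `p[i] ≥ q[i]` for every coordinate `i`. -/
def dominates {d : ℕ} (p q : Fin d → ℝ) : Prop := p ≠ q ∧ ∀ i, q i ≤ p i

/-- `p ⪰ q`: `p = q` or `p` dominates `q`. -/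
def domEq {d : ℕ} (p q : Fin d → ℝ) : Prop := p = q ∨ dominates p q

/-- The error of classifier `h` on a labeled multiset `Q`. -/
def errP {d : ℕ} (Q : Multiset ((Fin d → ℝ) × ℤ)) (h : (Fin d → ℝ) → ℤ) : ℕ :=
  Multiset.card (Q.filter (fun x => h x.1 ≠ x.2))

/-- One elimination step of RPE: remove from `P` every element `p ⪰ z` if
`label(z) = 1`, and every element `p ⪯ z` if `label(z) = −1`. -/
def Pz {d : ℕ} (P : Multiset ((Fin d → ℝ) × ℤ)) (z : (Fin d → ℝ) × ℤ) :
    Multiset ((Fin d → ℝ) × ℤ) :=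
  if z.2 = 1 then P.filter (fun p => ¬ domEq p.1 z.1)
  else P.filter (fun p => ¬ domEq z.1 p.1)

/-- The RPE algorithm with step budget `fuel`: while `P` is nonempty, probe a
uniformly random `z ∈ P`, add it to the output, and eliminate as in `Pz`.
Since each iteration removes at least the probed element, running it with
`fuel = |P|` realizes the RPE algorithm exactly. The result is the
distribution over the output set `Z` of probed elements. -/
def rpeAux {d : ℕ} : ℕ → Multiset ((Fin d → ℝ) × ℤ) → PMF (Multiset ((Fin d → ℝ) × ℤ))
  | 0, _ => PMF.pure 0
  | (fuel + 1), P =>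
    if hP : P = 0 then PMF.pure 0
    else (PMF.ofMultiset P hP).bind fun z =>
      (rpeAux fuel (Pz P z)).map (fun Z => z ::ₘ Z)

/-- The distribution over the output set `Z` produced by running RPE on `P`. -/
def rpe {d : ℕ} (P : Multiset ((Fin d → ℝ) × ℤ)) : PMF (Multiset ((Fin d → ℝ) × ℤ)) :=
  rpeAux (Multiset.card P) P

/-- The classifier `h_RPE` determined by the probed set `Z`. -/
def hRPE {d : ℕ} (Z : Multiset ((Fin d → ℝ) × ℤ)) : (Fin d → ℝ) → ℤ :=
  fun p => if ∃ z ∈ Z, z.2 = 1 ∧ domEq p z.1 then 1 else -1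

/-- `S` is an antichain (as a multiset): no two distinct elements `p, q` of `S`
satisfy `p ⪰ q`. -/
def IsAntichainMS {d : ℕ} (S : Multiset ((Fin d → ℝ) × ℤ)) : Prop :=
  S.Pairwise (fun a b => ¬ domEq a.1 b.1 ∧ ¬ domEq b.1 a.1)

/-- The width of `P` is `w`: `w` is the size of the largest antichain
sub-multiset of `P`. -/
def widthIs {d : ℕ} (P : Multiset ((Fin d → ℝ) × ℤ)) (w : ℕ) : Prop :=
  (∃ S ≤ P, IsAntichainMS S ∧ Multiset.card S = w) ∧
  ∀ S ≤ P, IsAntichainMS S → Multiset.card S ≤ w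

/-- **Dilworth's theorem**: a finite set in a partial order can be coloured, with every colour
class a chain, using at most as many colours as some antichain has elements. -/
theorem exists_chain_coloring_of_antichain {α : Type*} [PartialOrder α] (s : Finset α) :
    ∃ (k : ℕ) (c : α → ℕ) (t : Finset α),
      (∀ x ∈ s, c x < k) ∧ (∀ x ∈ s, ∀ y ∈ s, c x = c y → x ≤ y ∨ y ≤ x) ∧
      t ⊆ s ∧ IsAntichain (· ≤ ·) (t : Set α) ∧ t.card = k := by
  induction s using Finset.strongInduction with
  | H s ih =>
  rcases s.eq_empty_or_nonempty with rfl | hs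
  · exact ⟨0, fun _ => 0, ∅, by simp, by simp, by simp, by simp, rfl⟩
  obtain ⟨a, has, hmax⟩ := s.exists_maximal hs
  obtain ⟨k, c, t₀, hck, hc, ht₀s, ht₀, ht₀k⟩ := ih (s.erase a) (Finset.erase_ssubset has)
  have surj : ∀ t ⊆ s.erase a, IsAntichain (· ≤ ·) (t : Set α) → k ≤ t.card →
      t.card = k ∧ ∀ i < k, ∃ y ∈ t, c y = i := by
    intro t hts ht htk
    have hinj : Set.InjOn c t := by
      intro x hx y hy hxy
      rcases hc x (hts hx) y (hts hy) hxy with h | h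
      · exact ht.eq hx hy h
      · exact (ht.eq hy hx h).symm
    have hsub : t.image c ⊆ Finset.range k := by
      intro i hi
      obtain ⟨x, hx, rfl⟩ := Finset.mem_image.1 hi
      exact Finset.mem_range.2 (hck x (hts hx))
    have hcard : (t.image c).card = t.card := Finset.card_image_of_injOn hinj
    have heq : t.image c = Finset.range k :=
      Finset.eq_of_subset_of_card_le hsub (by simp [hcard, htk])
    refine ⟨by simpa [heq] using hcard.symm, fun i hi => ?_⟩
    have : i ∈ t.image c := by simp [heq, hi]
    simpa using this
  let X : ℕ → Finset α := fun i => (s.erase a).filter fun x => c x = i ∧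
    ∃ t ⊆ s.erase a, IsAntichain (· ≤ ·) (t : Set α) ∧ t.card = k ∧ x ∈ t
  have hX : ∀ i < k, ∃ x ∈ X i, ∀ y ∈ X i, y ≤ x := by
    intro i hi
    obtain ⟨y, hy, hyi⟩ := (surj t₀ ht₀s ht₀ ht₀k.ge).2 i hi
    obtain ⟨x, hx, hxmax⟩ := (X i).exists_maximal
      ⟨y, Finset.mem_filter.2 ⟨ht₀s hy, hyi, t₀, ht₀s, ht₀, ht₀k, hy⟩⟩
    refine ⟨x, hx, fun z hz => ?_⟩
    have hx' := Finset.mem_filter.1 hx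
    have hz' := Finset.mem_filter.1 hz
    rcases hc x hx'.1 z hz'.1 (hx'.2.1.trans hz'.2.1.symm) with h | h
    · exact hxmax hz h
    · exact h
  have : Nonempty α := ⟨a⟩
  choose! x hxX hxle using hX
  have hxs : ∀ i < k, x i ∈ s.erase a := fun i hi => (Finset.mem_filter.1 (hxX i hi)).1
  have hxc : ∀ i < k, c (x i) = i := fun i hi => (Finset.mem_filter.1 (hxX i hi)).2.1
  have hanti : ∀ i < k, ∀ j < k, x i ≤ x j → i = j := by
    intro i hi j hj hij
    obtain ⟨-, -, t, hts, ht, htk, hjt⟩ := Finset.mem_filter.1 (hxX j hj)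
    obtain ⟨y, hy, hyi⟩ := (surj t hts ht htk.ge).2 i hi
    have hyx : y ≤ x i := hxle i hi y (Finset.mem_filter.2 ⟨hts hy, hyi, t, hts, ht, htk, hy⟩)
    have : y = x j := ht.eq hy hjt (hyx.trans hij)
    rw [← hyi, this, hxc j hj]
  by_cases hcase : ∃ i < k, x i ≤ a
  · obtain ⟨i, hi, hia⟩ := hcase
    let K : α → Prop := fun z => z = a ∨ (c z = i ∧ z ≤ x i)
    have hKs : s.filter (fun z => ¬ K z) ⊂ s :=
      Finset.filter_ssubset.2 ⟨a, has, by simp [K]⟩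
    obtain ⟨k', c', t', hck', hc', hts', ht', htk'⟩ := ih _ hKs
    have hts'' : t' ⊆ s.erase a := fun z hz => by
      have := Finset.mem_filter.1 (hts' hz)
      exact Finset.mem_erase.2 ⟨fun h => this.2 (Or.inl h), this.1⟩
    have hlt : k' < k := by
      by_contra! hle
      obtain ⟨hcard, hsurj⟩ := surj t' hts'' ht' (htk' ▸ hle)
      obtain ⟨y, hy, hyi⟩ := hsurj i hi
      refine (Finset.mem_filter.1 (hts' hy)).2 (Or.inr ⟨hyi, hxle i hi y ?_⟩)
      exact Finset.mem_filter.2 ⟨hts'' hy, hyi, t', hts'', ht', hcard, hy⟩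
    refine ⟨k, fun z => if K z then k' else c' z, t₀, ?_, ?_,
      ht₀s.trans (Finset.erase_subset _ _), ht₀, ht₀k⟩
    · intro z hz
      by_cases hKz : K z
      · simpa [hKz] using hlt
      · simpa [hKz] using (hck' z (Finset.mem_filter.2 ⟨hz, hKz⟩)).trans hlt
    · intro y hy z hz hyz
      by_cases hKy : K y <;> by_cases hKz : K z <;> simp only [hKy, hKz, if_true, if_false] at hyz
      · rcases hKy with rfl | hKy <;> rcases hKz with rfl | hKz
        · exact Or.inl le_rfl
        · exact Or.inr (hKz.2.trans hia)
        · exact Or.inl (hKy.2.trans hia)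
        · by_cases hya : y = a
          · exact Or.inr (hya ▸ hKz.2.trans hia)
          by_cases hza : z = a
          · exact Or.inl (hza ▸ hKy.2.trans hia)
          exact hc y (Finset.mem_erase.2 ⟨hya, hy⟩) z (Finset.mem_erase.2 ⟨hza, hz⟩)
            (hKy.1.trans hKz.1.symm)
      · exact absurd hyz.symm (hck' z (Finset.mem_filter.2 ⟨hz, hKz⟩)).ne
      · exact absurd hyz (hck' y (Finset.mem_filter.2 ⟨hy, hKy⟩)).ne
      · exact hc' y (Finset.mem_filter.2 ⟨hy, hKy⟩) z (Finset.mem_filter.2 ⟨hz, hKz⟩) hyz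
  · push Not at hcase
    have hna : ∀ i < k, ¬ a ≤ x i := by
      intro i hi hle
      have := Finset.mem_erase.1 (hxs i hi)
      exact this.1 (le_antisymm (hmax this.2 hle) hle)
    have hinj : Set.InjOn x (Finset.range k : Set ℕ) := by
      intro i hi j hj hij
      exact hanti i (by simpa using hi) j (by simpa using hj) hij.le
    have hnot : a ∉ (Finset.range k).image x := by
      simp only [Finset.mem_image, Finset.mem_range, not_exists, not_and]
      exact fun i hi h => hna i hi h.ge
    refine ⟨k + 1, fun z => if z = a then k else c z, insert a ((Finset.range k).image x),
      ?_, ?_, ?_, ?_, ?_⟩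
    · intro z hz
      by_cases hza : z = a
      · simp [hza]
      · simpa [hza] using (hck z (Finset.mem_erase.2 ⟨hza, hz⟩)).trans (Nat.lt_succ_self k)
    · intro y hy z hz hyz
      by_cases hya : y = a <;> by_cases hza : z = a <;> simp only [hya, hza, if_true, if_false] at hyz
      · exact Or.inl (hya.trans hza.symm).le
      · exact absurd hyz.symm (hck z (Finset.mem_erase.2 ⟨hza, hz⟩)).ne
      · exact absurd hyz (hck y (Finset.mem_erase.2 ⟨hya, hy⟩)).ne
      · exact hc y (Finset.mem_erase.2 ⟨hya, hy⟩) z (Finset.mem_erase.2 ⟨hza, hz⟩) hyz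
    · intro z hz
      rcases Finset.mem_insert.1 hz with rfl | hz
      · exact has
      · obtain ⟨i, hi, rfl⟩ := Finset.mem_image.1 hz
        exact Finset.mem_of_mem_erase (hxs i (Finset.mem_range.1 hi))
    · intro y hy z hz hne hle
      simp only [Finset.coe_insert, Finset.coe_image, Finset.coe_range, Set.mem_insert_iff,
        Set.mem_image, Set.mem_Iio] at hy hz
      rcases hy with rfl | ⟨i, hi, rfl⟩ <;> rcases hz with rfl | ⟨j, hj, rfl⟩
      · exact hne rfl
      · exact hna j hj hle
      · exact hcase i hi hle
      · exact hne (congrArg x (hanti i hi j hj hle))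
    · rw [Finset.card_insert_of_notMem hnot, Finset.card_image_of_injOn hinj, Finset.card_range]

/-- The expected value of `g` under a probability mass function `p`. -/
def PMF.expect {α : Type*} (p : PMF α) (g : α → ℝ≥0∞) : ℝ≥0∞ := ∑' a, p a * g a

theorem PMF.expect_pure {α : Type*} (a : α) (g : α → ℝ≥0∞) : (PMF.pure a).expect g = g a := by
  rw [PMF.expect, tsum_eq_single a]
  · simp
  · intro b hb
    simp [PMF.pure_apply, hb]

theorem PMF.expect_bind {α β : Type*} (p : PMF α) (f : α → PMF β) (g : β → ℝ≥0∞) :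
    (p.bind f).expect g = p.expect fun a => (f a).expect g := by
  simp only [PMF.expect, PMF.bind_apply, ← ENNReal.tsum_mul_right, ← ENNReal.tsum_mul_left,
    mul_assoc]
  exact ENNReal.tsum_comm

theorem PMF.expect_map {α β : Type*} (p : PMF α) (f : α → β) (g : β → ℝ≥0∞) :
    (p.map f).expect g = p.expect (g ∘ f) := by
  rw [← PMF.bind_pure_comp, PMF.expect_bind]
  simp only [Function.comp_def, PMF.expect_pure]

theorem PMF.expect_one_add {α : Type*} (p : PMF α) (g : α → ℝ≥0∞) :
    (p.expect fun a => 1 + g a) = 1 + p.expect g := by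
  simp [PMF.expect, mul_add, ENNReal.tsum_add, p.tsum_coe]

theorem PMF.expect_ofMultiset {α : Type*} (s : Multiset α) (hs : s ≠ 0) (g : α → ℝ≥0∞) :
    (PMF.ofMultiset s hs).expect g = (s.map g).sum / Multiset.card s := by
  rw [PMF.expect, tsum_eq_sum (s := s.toFinset), Finset.sum_multiset_map_count, div_eq_mul_inv,
    Finset.sum_mul]
  · refine Finset.sum_congr rfl fun a _ => ?_
    rw [PMF.ofMultiset_apply, nsmul_eq_mul, div_eq_mul_inv]
    ring
  · intro b hb
    rw [PMF.ofMultiset_apply_of_notMem _ (by simpa using hb), zero_mul]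

theorem expect_card_rpeAux_succ {d : ℕ} (fuel : ℕ) (P : Multiset ((Fin d → ℝ) × ℤ)) (hP : P ≠ 0) :
    (rpeAux (fuel + 1) P).expect (fun Z => (Multiset.card Z : ℝ≥0∞)) =
      (P.map fun z => 1 + (rpeAux fuel (Pz P z)).expect
        fun Z => (Multiset.card Z : ℝ≥0∞)).sum / Multiset.card P := by
  rw [rpeAux, dif_neg hP, PMF.expect_bind, PMF.expect_ofMultiset]
  simp only [PMF.expect_map, Function.comp_def, Multiset.card_cons, Nat.cast_add, Nat.cast_one,
    add_comm _ (1 : ℝ≥0∞), PMF.expect_one_add]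

theorem domEq_iff_le {d : ℕ} (p q : Fin d → ℝ) : domEq p q ↔ q ≤ p := by
  unfold domEq dominates
  refine ⟨?_, fun h => ?_⟩
  · rintro (rfl | h)
    · exact le_rfl
    · exact h.2
  · by_cases hpq : p = q
    · exact Or.inl hpq
    · exact Or.inr ⟨hpq, h⟩

/-- Probing `z` removes `p`. -/
def Eliminates {d : ℕ} (z p : (Fin d → ℝ) × ℤ) : Prop :=
  if z.2 = 1 then z.1 ≤ p.1 else p.1 ≤ z.1

theorem Eliminates.self {d : ℕ} (z : (Fin d → ℝ) × ℤ) : Eliminates z z := by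
  unfold Eliminates
  split_ifs <;> exact le_rfl

theorem Pz_eq_filter {d : ℕ} (P : Multiset ((Fin d → ℝ) × ℤ)) (z : (Fin d → ℝ) × ℤ) :
    Pz P z = P.filter fun p => ¬ Eliminates z p := by
  unfold Pz Eliminates
  split_ifs <;> simp only [domEq_iff_le]

theorem card_Pz_add_countP {d : ℕ} (P : Multiset ((Fin d → ℝ) × ℤ)) (z : (Fin d → ℝ) × ℤ) :
    Multiset.card (Pz P z) + P.countP (Eliminates z) = Multiset.card P := by
  rw [Multiset.card_eq_countP_add_countP (Eliminates z) P, Pz_eq_filter,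
    ← Multiset.countP_eq_card_filter, add_comm]

theorem Pz_sum {d : ℕ} {ι : Type*} (s : Finset ι) (C : ι → Multiset ((Fin d → ℝ) × ℤ))
    (z : (Fin d → ℝ) × ℤ) : Pz (∑ i ∈ s, C i) z = ∑ i ∈ s, Pz (C i) z := by
  simp only [Pz_eq_filter]
  induction s using Finset.induction_on with
  | empty => simp
  | insert a s ha ih => rw [Finset.sum_insert ha, Finset.sum_insert ha, Multiset.filter_add, ih]

/-- The points of `C` are pairwise comparable. -/
def IsChainMS {d : ℕ} (C : Multiset ((Fin d → ℝ) × ℤ)) : Prop :=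
  ∀ a ∈ C, ∀ b ∈ C, a.1 ≤ b.1 ∨ b.1 ≤ a.1

theorem IsChainMS.mono {d : ℕ} {C D : Multiset ((Fin d → ℝ) × ℤ)} (hC : IsChainMS C)
    (h : D ≤ C) : IsChainMS D :=
  fun a ha b hb => hC a (Multiset.mem_of_le h ha) b (Multiset.mem_of_le h hb)

theorem IsChainMS.eliminate {d : ℕ} {C : Multiset ((Fin d → ℝ) × ℤ)} (hC : IsChainMS C)
    (z : (Fin d → ℝ) × ℤ) : IsChainMS (Pz C z) := by
  rw [Pz_eq_filter]
  exact hC.mono (Multiset.filter_le _ _)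

theorem IsChainMS.exists_max {d : ℕ} {C : Multiset ((Fin d → ℝ) × ℤ)} (hC : IsChainMS C)
    (h : C ≠ 0) : ∃ a ∈ C, ∀ b ∈ C, b.1 ≤ a.1 := by
  obtain ⟨x, hx⟩ := Multiset.exists_mem_of_ne_zero h
  obtain ⟨a, ha, hmax⟩ := C.toFinset.exists_maximalFor (fun b => b.1) ⟨x, by simpa using hx⟩
  rw [Multiset.mem_toFinset] at ha
  refine ⟨a, ha, fun b hb => ?_⟩
  exact (hC b hb a ha).elim id fun hab => hmax (by simpa using hb) hab

theorem IsChainMS.exists_min {d : ℕ} {C : Multiset ((Fin d → ℝ) × ℤ)} (hC : IsChainMS C)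
    (h : C ≠ 0) : ∃ a ∈ C, ∀ b ∈ C, a.1 ≤ b.1 := by
  obtain ⟨x, hx⟩ := Multiset.exists_mem_of_ne_zero h
  obtain ⟨a, ha, hmin⟩ := C.toFinset.exists_minimalFor (fun b => b.1) ⟨x, by simpa using hx⟩
  rw [Multiset.mem_toFinset] at ha
  refine ⟨a, ha, fun b hb => ?_⟩
  exact (hC a ha b hb).elim id fun hab => hmin (by simpa using hb) hab

/-- On average, probing an element of a chain of size `m` removes at least `(m + 2) / 4` of it,
whatever the labels. -/
theorem IsChainMS.sum_countP_eliminates {d : ℕ} {C : Multiset ((Fin d → ℝ) × ℤ)}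
    (hC : IsChainMS C) :
    Multiset.card C * (Multiset.card C + 2) ≤
      4 * (C.map fun z => C.countP (Eliminates z)).sum := by
  induction C using Multiset.strongInductionOn with
  | ih C ih =>
  by_cases h0 : C = 0
  · simp [h0]
  obtain ⟨a, ha, hmax⟩ := hC.exists_max h0
  obtain ⟨C', rfl⟩ := Multiset.exists_cons_of_mem ha
  by_cases h1 : C' = 0
  · subst h1
    have : 0 < (a ::ₘ 0).countP (Eliminates a) :=
      Multiset.countP_pos.2 ⟨a, by simp, Eliminates.self a⟩
    simp only [Multiset.map_cons, Multiset.map_zero, Multiset.sum_cons, Multiset.sum_zero,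
      Multiset.card_cons, Multiset.card_zero]
    omega
  obtain ⟨b, hb, hmin⟩ := (hC.mono (Multiset.le_cons_self C' a)).exists_min h1
  obtain ⟨D, rfl⟩ := Multiset.exists_cons_of_mem hb
  have hle : D ≤ a ::ₘ b ::ₘ D := (Multiset.le_cons_self D b).trans (Multiset.le_cons_self _ a)
  have hD := ih D (lt_of_le_of_ne hle fun h => by
    have := congrArg Multiset.card h
    simp only [Multiset.card_cons] at this
    omega) (hC.mono hle)
  have hsum : (D.map fun z => 1 + D.countP (Eliminates z)).sum ≤
      (D.map fun z => (a ::ₘ b ::ₘ D).countP (Eliminates z)).sum := by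
    refine Multiset.sum_map_le_sum_map _ _ fun z hz => ?_
    simp only [Multiset.countP_cons]
    have hza : z.1 ≤ a.1 := hmax z (Multiset.mem_of_le hle hz)
    have hzb : b.1 ≤ z.1 := hmin z (Multiset.mem_of_le (Multiset.le_cons_self D b) hz)
    have : Eliminates z a ∨ Eliminates z b := by
      unfold Eliminates
      split_ifs
      · exact Or.inl hza
      · exact Or.inr hzb
    rcases this with h | h <;> simp only [h, if_true] <;> omega
  have hpos : ∀ z ∈ a ::ₘ b ::ₘ D, 1 ≤ (a ::ₘ b ::ₘ D).countP (Eliminates z) := fun z hz =>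
    Multiset.countP_pos.2 ⟨z, hz, Eliminates.self z⟩
  have h1 := hpos a (by simp)
  have h2 := hpos b (by simp)
  rw [Multiset.sum_map_add] at hsum
  simp only [Multiset.map_const', Multiset.sum_replicate, smul_eq_mul, mul_one] at hsum
  simp only [Multiset.map_cons, Multiset.sum_cons, Multiset.card_cons] at *
  nlinarith

/-- The potential of a chain of size `m`. -/
def chainPotential (m : ℕ) : ℝ := 4 * Real.log (1 + m)

theorem chainPotential_nonneg (m : ℕ) : 0 ≤ chainPotential m :=
  mul_nonneg (by norm_num) (Real.log_nonneg (by simp))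

theorem le_chainPotential_sub {m k r : ℕ} (h : k + r = m) :
    4 * (r : ℝ) / (m + 1) ≤ chainPotential m - chainPotential k := by
  subst h
  have hk : (0 : ℝ) < 1 + k := by positivity
  have hm : (0 : ℝ) < 1 + (k + r : ℕ) := by positivity
  have h := Real.one_sub_inv_le_log_of_pos (div_pos hm hk)
  rw [Real.log_div hm.ne' hk.ne', inv_div] at h
  have : 4 * (r : ℝ) / ((k + r : ℕ) + 1) = 4 * (1 - (1 + k) / (1 + (k + r : ℕ))) := by
    field_simp
    push_cast
    ring
  unfold chainPotential
  linarith

theorem chainPotential_sub_card_Pz_nonneg {d : ℕ} (C : Multiset ((Fin d → ℝ) × ℤ))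
    (z : (Fin d → ℝ) × ℤ) :
    0 ≤ chainPotential (Multiset.card C) - chainPotential (Multiset.card (Pz C z)) :=
  (le_chainPotential_sub (card_Pz_add_countP C z)).trans' (by positivity)

theorem IsChainMS.card_le_sum_potential_drop {d : ℕ} {C : Multiset ((Fin d → ℝ) × ℤ)}
    (hC : IsChainMS C) :
    (Multiset.card C : ℝ) ≤ (C.map fun z =>
      chainPotential (Multiset.card C) - chainPotential (Multiset.card (Pz C z))).sum := by
  have h1 : (C.map fun z => (C.countP (Eliminates z) : ℝ) * (4 / (Multiset.card C + 1))).sum ≤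
      (C.map fun z =>
        chainPotential (Multiset.card C) - chainPotential (Multiset.card (Pz C z))).sum := by
    refine Multiset.sum_map_le_sum_map _ _ fun z _ => ?_
    refine le_trans (le_of_eq ?_) (le_chainPotential_sub (card_Pz_add_countP C z))
    ring
  refine le_trans ?_ h1
  rw [Multiset.sum_map_mul_right]
  have h2 : (Multiset.card C * (Multiset.card C + 2) : ℝ) ≤
      4 * (C.map fun z => (C.countP (Eliminates z) : ℝ)).sum := by
    have := hC.sum_countP_eliminates
    have hcast : (((C.map fun z => C.countP (Eliminates z)).sum : ℕ) : ℝ) =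
        (C.map fun z => (C.countP (Eliminates z) : ℝ)).sum := by
      simp [Nat.cast_multiset_sum, Multiset.map_map]
    rw [← hcast]
    exact_mod_cast this
  rw [mul_div_assoc', le_div_iff₀ (by positivity)]
  nlinarith [(Multiset.card C).cast_nonneg (α := ℝ)]

theorem card_le_sum_potential_drop {d w : ℕ} (C : Fin w → Multiset ((Fin d → ℝ) × ℤ))
    (hC : ∀ i, IsChainMS (C i)) :
    (Multiset.card (∑ i, C i) : ℝ) ≤ ((∑ i, C i).map fun z => ∑ i,
      (chainPotential (Multiset.card (C i)) - chainPotential (Multiset.card (Pz (C i) z)))).sum := by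
  refine le_of_le_of_eq ?_ (Multiset.sum_map_sum_map (Finset.univ : Finset (Fin w)).val _)
  rw [Multiset.card_sum, Nat.cast_sum]
  refine Finset.sum_le_sum fun i _ => (hC i).card_le_sum_potential_drop.trans ?_
  obtain ⟨D, hD⟩ := Multiset.le_iff_exists_add.1
    (Finset.single_le_sum (f := C) (fun j _ => Multiset.zero_le (C j)) (Finset.mem_univ i))
  rw [hD, Multiset.map_add, Multiset.sum_add]
  refine le_add_of_nonneg_right (Multiset.sum_nonneg fun x hx => ?_)
  obtain ⟨z, -, rfl⟩ := Multiset.mem_map.1 hx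
  exact chainPotential_sub_card_Pz_nonneg _ _

theorem expect_card_rpeAux_le {d w : ℕ} (fuel : ℕ) (C : Fin w → Multiset ((Fin d → ℝ) × ℤ))
    (hC : ∀ i, IsChainMS (C i)) :
    (rpeAux fuel (∑ i, C i)).expect (fun Z => (Multiset.card Z : ℝ≥0∞)) ≤
      ENNReal.ofReal (∑ i, chainPotential (Multiset.card (C i))) := by
  induction fuel generalizing C with
  | zero => simp [rpeAux, PMF.expect_pure]
  | succ fuel ih =>
  by_cases hP : ∑ i, C i = 0
  · simp [rpeAux, hP, PMF.expect_pure]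
  have hcard : 0 < Multiset.card (∑ i, C i) := Multiset.card_pos.2 hP
  have hdrop := card_le_sum_potential_drop C hC
  rw [expect_card_rpeAux_succ _ _ hP]
  set P := ∑ i, C i with hPdef
  set Φ := ∑ i, chainPotential (Multiset.card (C i)) with hΦ
  have hΦ0 : 0 ≤ Φ := Finset.sum_nonneg fun i _ => chainPotential_nonneg _
  have hnonneg : ∀ z, 0 ≤ ∑ i, chainPotential (Multiset.card (Pz (C i) z)) := fun z =>
    Finset.sum_nonneg fun i _ => chainPotential_nonneg _
  rw [ENNReal.div_le_iff (by simpa using hP) (by simp), ← ENNReal.ofReal_natCast,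
    ← ENNReal.ofReal_mul hΦ0]
  have hstep : (P.map fun z => 1 + (rpeAux fuel (Pz P z)).expect
        fun Z => (Multiset.card Z : ℝ≥0∞)).sum ≤
      (P.map fun z => ENNReal.ofReal
        (1 + ∑ i, chainPotential (Multiset.card (Pz (C i) z)))).sum := by
    refine Multiset.sum_map_le_sum_map _ _ fun z _ => ?_
    rw [ENNReal.ofReal_add zero_le_one (hnonneg z), ENNReal.ofReal_one, hPdef, Pz_sum]
    gcongr
    exact ih _ fun i => (hC i).eliminate z
  have hreal : ∀ Q : Multiset ((Fin d → ℝ) × ℤ), (Q.map fun z => ENNReal.ofReal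
        (1 + ∑ i, chainPotential (Multiset.card (Pz (C i) z)))).sum = ENNReal.ofReal
      (Q.map fun z => 1 + ∑ i, chainPotential (Multiset.card (Pz (C i) z))).sum := by
    intro Q
    induction Q using Multiset.induction_on with
    | empty => simp
    | cons a Q ihQ =>
      rw [Multiset.map_cons, Multiset.sum_cons, ihQ, Multiset.map_cons, Multiset.sum_cons,
        ENNReal.ofReal_add (add_nonneg zero_le_one (hnonneg a))]
      refine Multiset.sum_nonneg fun x hx => ?_
      obtain ⟨z, -, rfl⟩ := Multiset.mem_map.1 hx
      exact add_nonneg zero_le_one (hnonneg z)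
  refine hstep.trans ((hreal P).le.trans (ENNReal.ofReal_le_ofReal ?_))
  simp only [Finset.sum_sub_distrib, ← hΦ] at hdrop
  rw [Multiset.sum_map_sub] at hdrop
  rw [Multiset.sum_map_add]
  simp only [Multiset.map_const', Multiset.sum_replicate, nsmul_eq_mul, mul_one] at hdrop ⊢
  linarith

theorem sum_chainPotential_le {w n : ℕ} (m : Fin w → ℕ) (hm : ∑ i, m i = n) :
    ∑ i, chainPotential (m i) ≤ 4 * w * Real.logb 2 (1 + (n : ℝ) / w) := by
  rcases Nat.eq_zero_or_pos w with rfl | hw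
  · simp
  have hw' : (0 : ℝ) < w := by exact_mod_cast hw
  set y : ℝ := 1 + (n : ℝ) / w with hy
  have hy1 : 1 ≤ y := by
    rw [hy]
    exact le_add_of_nonneg_right (by positivity)
  have hy0 : 0 < y := by linarith
  have hlog : ∀ i, chainPotential (m i) ≤ 4 * (Real.log y + ((1 + m i) / y - 1)) := by
    intro i
    have hx : (0 : ℝ) < 1 + m i := by positivity
    have := Real.log_le_sub_one_of_pos (div_pos hx hy0)
    rw [Real.log_div hx.ne' hy0.ne'] at this
    unfold chainPotential
    linarith
  have hbase : Real.log y ≤ Real.logb 2 y := by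
    rw [Real.logb, le_div_iff₀ (Real.log_pos one_lt_two)]
    exact mul_le_of_le_one_right (Real.log_nonneg hy1)
      ((Real.log_le_sub_one_of_pos two_pos).trans (by norm_num))
  calc ∑ i, chainPotential (m i)
      ≤ ∑ i, 4 * (Real.log y + ((1 + m i) / y - 1)) := Finset.sum_le_sum fun i _ => hlog i
    _ = 4 * w * Real.log y := by
      have hn : ∑ i, (m i : ℝ) = n := by exact_mod_cast hm
      rw [← Finset.mul_sum, Finset.sum_add_distrib, Finset.sum_sub_distrib, ← Finset.sum_div,
        Finset.sum_add_distrib, hn]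
      simp only [Finset.sum_const, Finset.card_univ, Fintype.card_fin, nsmul_eq_mul, mul_one]
      have : (w + n : ℝ) / y = w := by
        rw [div_eq_iff hy0.ne', hy]
        field_simp
      rw [this]
      ring
    _ ≤ 4 * w * Real.logb 2 y := by gcongr

theorem Multiset.sum_filter_eq_of_lt {α : Type*} {k : ℕ} (s : Multiset α) (c : α → ℕ)
    (h : ∀ x ∈ s, c x < k) : ∑ j : Fin k, s.filter (fun x => c x = j) = s := by
  induction s using Multiset.induction_on with
  | empty => simp
  | cons a s ih =>
    have hj : ∀ j : Fin k, c a = j ↔ (⟨c a, h a (by simp)⟩ : Fin k) = j := fun j => by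
      simp [Fin.ext_iff]
    simp only [Multiset.filter_cons, Finset.sum_add_distrib,
      ih fun x hx => h x (Multiset.mem_cons_of_mem hx), hj, Finset.sum_ite_eq, Finset.mem_univ,
      if_true, Multiset.singleton_add]

theorem exists_chain_partition {d : ℕ} (P : Multiset ((Fin d → ℝ) × ℤ)) (w : ℕ)
    (h : ∀ S ≤ P, IsAntichainMS S → Multiset.card S ≤ w) :
    ∃ C : Fin w → Multiset ((Fin d → ℝ) × ℤ), (∀ i, IsChainMS (C i)) ∧ ∑ i, C i = P := by
  obtain ⟨n, f, rfl⟩ : ∃ (n : ℕ) (f : Fin n → (Fin d → ℝ) × ℤ),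
      (Finset.univ : Finset (Fin n)).val.map f = P :=
    ⟨P.toList.length, P.toList.get, by
      rw [Fin.univ_val_map, List.ofFn_get, Multiset.coe_toList]⟩
  let e : Fin n → (Fin d → ℝ) ×ₗ Fin n := fun i => toLex ((f i).1, i)
  have he : Function.Injective e := fun i j hij => (Prod.ext_iff.1 (toLex.injective hij)).2
  have hle_of : ∀ i j, e i ≤ e j → (f i).1 ≤ (f j).1 := fun i j hij => by
    rcases Prod.Lex.toLex_le_toLex.1 hij with h | h
    · exact h.le
    · exact h.1.le
  have hcomp : ∀ i j, (f i).1 ≤ (f j).1 → e i ≤ e j ∨ e j ≤ e i := fun i j hij => by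
    rcases hij.lt_or_eq with h | h
    · exact Or.inl (Prod.Lex.toLex_le_toLex.2 (Or.inl h))
    · rcases le_total i j with hl | hl
      · exact Or.inl (Prod.Lex.toLex_le_toLex.2 (Or.inr ⟨h, hl⟩))
      · exact Or.inr (Prod.Lex.toLex_le_toLex.2 (Or.inr ⟨h.symm, hl⟩))
  obtain ⟨k, c, t, hck, hc, hts, ht, htk⟩ :=
    exists_chain_coloring_of_antichain (Finset.univ.image e)
  obtain ⟨u, -, rfl⟩ := Finset.subset_image_iff.1 hts
  have hkw : k ≤ w := by
    have hu := h (u.val.map f) (Multiset.map_le_map (Finset.val_le_iff.2 u.subset_univ))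
      ⟨u.toList.map f, by simp [← Multiset.map_coe], by
        rw [List.pairwise_map]
        refine u.nodup_toList.pairwise_of_forall_ne fun i hi j hj hij => ?_
        have hi' : e i ∈ (u.image e : Set _) := by
          simpa using ⟨i, Finset.mem_toList.1 hi, rfl⟩
        have hj' : e j ∈ (u.image e : Set _) := by
          simpa using ⟨j, Finset.mem_toList.1 hj, rfl⟩
        have h1 : ¬ e i ≤ e j := fun hle => hij (he (ht.eq hi' hj' hle))
        have h2 : ¬ e j ≤ e i := fun hle => hij (he (ht.eq hj' hi' hle)).symm
        rw [domEq_iff_le, domEq_iff_le]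
        exact ⟨fun hle => (hcomp j i hle).elim h2 h1, fun hle => (hcomp i j hle).elim h1 h2⟩⟩
    rw [← htk, Finset.card_image_of_injective _ he]
    simpa using hu
  refine ⟨fun j => ((Finset.univ : Finset (Fin n)).val.filter fun i => c (e i) = j).map f, ?_, ?_⟩
  · intro j a ha b hb
    obtain ⟨x, hx, rfl⟩ := Multiset.mem_map.1 ha
    obtain ⟨y, hy, rfl⟩ := Multiset.mem_map.1 hb
    have hxy := (Multiset.mem_filter.1 hx).2.trans (Multiset.mem_filter.1 hy).2.symm
    exact (hc (e x) (by simp) (e y) (by simp) hxy).imp (hle_of x y) (hle_of y x)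
  · rw [← Multiset.coe_mapAddMonoidHom, ← map_sum, Multiset.sum_filter_eq_of_lt]
    exact fun x _ => (hck (e x) (by simp)).trans_le hkw

/-- There is a universal constant `C` such that for every input `P` of `n`
labeled points with width `w`, the expected number of elements probed by RPE
(equivalently, the expected size of the output set `Z`) is at most
`C · w · log₂(1 + n/w)`. -/
theorem stmt5 :
    ∃ C : ℝ, 0 < C ∧ ∀ (d : ℕ) (P : Multiset ((Fin d → ℝ) × ℤ)) (w : ℕ),
      (∀ x ∈ P, x.2 = 1 ∨ x.2 = (-1 : ℤ)) → widthIs P w →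
      ∑' Z : Multiset ((Fin d → ℝ) × ℤ), (rpe P) Z * (Multiset.card Z : ℝ≥0∞)
        ≤ ENNReal.ofReal
            (C * w * Real.logb 2 (1 + (Multiset.card P : ℝ) / w)) := by
  refine ⟨4, by norm_num, fun d P w _ hw => ?_⟩
  obtain ⟨C, hC, rfl⟩ := exists_chain_partition P w hw.2
  refine (expect_card_rpeAux_le _ C hC).trans (ENNReal.ofReal_le_ofReal ?_)
  exact sum_chainPotential_le _ (Multiset.card_sum _ _).symm
end
end

section
/- Consider the attrition-and-elimination game on a chain C of m ≥ 1 points in ℝ^d. In each round, first Bob deletes an arbitrary (possibly empty) subset of the current C, where Bob's choice is given by an arbitrary fixed strategy, i.e., a function of the entire history of the game so far; then, if C is nonempty, Alice picks a point p uniformly at random from C and deletes from C every point q with q ⪰ p. The game ends when C is empty. Then, for every strategy of Bob, the expected number of rounds is at most 2·log₂(1 + m) + 1. -/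
open scoped Classical ENNReal

noncomputable section

/-- The attrition-and-elimination game on a current set `C`, with a step
budget `fuel` and the game history `hist` (the list of pairs consisting of the
set right after Bob's attrition together with Alice's random pick, most recent
first). In a round (played while `C` is nonempty), Bob first replaces `C` by
`strat hist C` (his attrition, an arbitrary function of the history), and then
Alice picks a uniformly random point `p` of the remaining set and deletes
every point `q ⪰ p`. The value is the distribution of the number of rounds
played. Since every round removes at least Alice's pick, running with
`fuel = |C|` realizes the game exactly. -/
def aeGame {d : ℕ}
    (strat : List (Finset (Fin d → ℝ) × (Fin d → ℝ)) → Finset (Fin d → ℝ) → Finset (Fin d → ℝ)) :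
    ℕ → Finset (Fin d → ℝ) → List (Finset (Fin d → ℝ) × (Fin d → ℝ)) → PMF ℕ
  | 0, _, _ => PMF.pure 0
  | (fuel + 1), C, hist =>
    if C.Nonempty then
      if hC' : (strat hist C).Nonempty then
        (PMF.uniformOfFinset (strat hist C) hC').bind fun p =>
          (aeGame strat fuel ((strat hist C).filter (fun q => ¬ domEq q p))
              ((strat hist C, p) :: hist)).map (· + 1)
      else PMF.pure 1
    else PMF.pure 0

/-- On a chain, sending each element to the number of elements not above it is a bijection onto
an initial segment of `ℕ`. -/
theorem image_card_filter_not_le {α : Type*} [PartialOrder α] (s : Finset α)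
    (hs : ∀ p ∈ s, ∀ q ∈ s, p ≤ q ∨ q ≤ p) :
    Set.InjOn (fun p => (s.filter (fun q => ¬ p ≤ q)).card) s ∧
      s.image (fun p => (s.filter (fun q => ¬ p ≤ q)).card) = Finset.range s.card := by
  have key : ∀ p ∈ s, ∀ q ∈ s, p < q →
      (s.filter (fun r => ¬ p ≤ r)).card < (s.filter (fun r => ¬ q ≤ r)).card := by
    intro p hp q _ hpq
    apply Finset.card_lt_card
    rw [Finset.ssubset_iff_of_subset
      (Finset.monotone_filter_right _ fun r _ hr hqr => hr (hpq.le.trans hqr))]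
    exact ⟨p, by simp [hp, hpq.not_ge], by simp⟩
  have inj : Set.InjOn (fun p => (s.filter (fun q => ¬ p ≤ q)).card) s := by
    intro p hp q hq h
    by_contra hne
    rcases hs p hp q hq with hle | hle
    · exact (key p hp q hq (lt_of_le_of_ne hle hne)).ne h
    · exact (key q hq p hp (lt_of_le_of_ne hle (Ne.symm hne))).ne h.symm
  refine ⟨inj, Finset.eq_of_subset_of_card_le ?_ ?_⟩
  · intro k hk
    obtain ⟨p, hp, rfl⟩ := Finset.mem_image.1 hk
    exact Finset.mem_range.2 (Finset.card_lt_card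
      (Finset.filter_ssubset.2 ⟨p, hp, by simp⟩))
  · rw [Finset.card_image_of_injOn inj, Finset.card_range]

theorem sum_card_filter_not_le {α M : Type*} [PartialOrder α] [AddCommMonoid M] (s : Finset α)
    (hs : ∀ p ∈ s, ∀ q ∈ s, p ≤ q ∨ q ≤ p) (g : ℕ → M) :
    ∑ p ∈ s, g (s.filter (fun q => ¬ p ≤ q)).card = ∑ j ∈ Finset.range s.card, g j := by
  obtain ⟨inj, him⟩ := image_card_filter_not_le s hs
  rw [← him, Finset.sum_image inj]

theorem sum_range_harmonic_add_one (n : ℕ) :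
    ∑ j ∈ Finset.range n, (harmonic j + 1) = n * harmonic n := by
  induction n with
  | zero => simp
  | succ n ih =>
    rw [Finset.sum_range_succ, ih, harmonic_succ]
    push_cast
    field_simp
    ring

theorem harmonic_nonneg (n : ℕ) : 0 ≤ harmonic n :=
  Finset.sum_nonneg fun i _ => by positivity

theorem harmonic_mono : Monotone harmonic :=
  monotone_nat_of_le_succ fun n => by
    rw [harmonic_succ]
    exact le_add_of_nonneg_right (by positivity)

theorem sum_range_ofReal_harmonic_add_one (n : ℕ) :
    ∑ j ∈ Finset.range n, (ENNReal.ofReal (harmonic j : ℝ) + 1)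
      = n * ENNReal.ofReal (harmonic n : ℝ) := by
  have hnn : ∀ j, (0 : ℝ) ≤ harmonic j := fun j => by exact_mod_cast harmonic_nonneg j
  have h : ∀ j ∈ Finset.range n, ENNReal.ofReal (harmonic j : ℝ) + 1
      = ENNReal.ofReal ((harmonic j : ℝ) + 1) := fun j _ => by
    rw [ENNReal.ofReal_add (hnn j) zero_le_one, ENNReal.ofReal_one]
  rw [Finset.sum_congr rfl h, ← ENNReal.ofReal_sum_of_nonneg fun j _ => by linarith [hnn j],
    ← ENNReal.ofReal_natCast n, ← ENNReal.ofReal_mul n.cast_nonneg]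
  congr 1
  exact_mod_cast sum_range_harmonic_add_one n

theorem PMF.tsum_pure_mul {α : Type*} (a : α) (g : α → ℝ≥0∞) :
    ∑' k, PMF.pure a k * g k = g a := by
  rw [tsum_eq_single a fun b hb => by simp [PMF.pure_apply, hb]]
  simp

theorem PMF.tsum_bind_mul {α β : Type*} (p : PMF α) (f : α → PMF β) (g : β → ℝ≥0∞) :
    ∑' k, p.bind f k * g k = ∑' a, p a * ∑' k, f a k * g k := by
  simp only [PMF.bind_apply, ← ENNReal.tsum_mul_right, ← ENNReal.tsum_mul_left, mul_assoc]
  exact ENNReal.tsum_comm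

theorem PMF.tsum_map_mul {α β : Type*} (p : PMF α) (f : α → β) (g : β → ℝ≥0∞) :
    ∑' k, p.map f k * g k = ∑' a, p a * g (f a) := by
  rw [PMF.map, PMF.tsum_bind_mul]
  simp only [Function.comp_apply, PMF.tsum_pure_mul]

theorem PMF.tsum_map_add_one_mul (p : PMF ℕ) :
    ∑' k, p.map (fun i : ℕ => i + 1) k * (k : ℝ≥0∞) = ∑' k, p k * (k : ℝ≥0∞) + 1 := by
  rw [PMF.tsum_map_mul]
  simp only [Nat.cast_add, Nat.cast_one, mul_add, mul_one, ENNReal.tsum_add, p.tsum_coe]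

theorem PMF.tsum_uniformOfFinset_mul {α : Type*} (s : Finset α) (hs : s.Nonempty)
    (g : α → ℝ≥0∞) :
    ∑' a, PMF.uniformOfFinset s hs a * g a = (s.card : ℝ≥0∞)⁻¹ * ∑ a ∈ s, g a := by
  rw [tsum_eq_sum (s := s) fun a ha => by simp [PMF.uniformOfFinset_apply, ha], Finset.mul_sum]
  exact Finset.sum_congr rfl fun a ha => by simp [PMF.uniformOfFinset_apply, ha]

/-- Whatever Bob's strategy, the expected number of rounds on a chain of `n` points is at most the
`n`-th harmonic number. -/
theorem expected_rounds_le_harmonic {d : ℕ}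
    (strat : List (Finset (Fin d → ℝ) × (Fin d → ℝ)) → Finset (Fin d → ℝ) → Finset (Fin d → ℝ))
    (hstrat : ∀ hist D, strat hist D ⊆ D) (fuel : ℕ) (C : Finset (Fin d → ℝ))
    (hist : List (Finset (Fin d → ℝ) × (Fin d → ℝ)))
    (hchain : ∀ p ∈ C, ∀ q ∈ C, p ≤ q ∨ q ≤ p) :
    ∑' k : ℕ, aeGame strat fuel C hist k * (k : ℝ≥0∞) ≤ ENNReal.ofReal (harmonic C.card : ℝ) := by
  induction fuel generalizing C hist with
  | zero => simp [aeGame]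
  | succ fuel ih =>
    rw [aeGame]
    split_ifs with hC hS
    · have hSC := hstrat hist C
      generalize strat hist C = S at hS hSC ⊢
      have hSchain : ∀ p ∈ S, ∀ q ∈ S, p ≤ q ∨ q ≤ p :=
        fun p hp q hq => hchain p (hSC hp) q (hSC hq)
      simp only [PMF.tsum_bind_mul, PMF.tsum_uniformOfFinset_mul, PMF.tsum_map_add_one_mul,
        domEq_iff_le]
      calc _ ≤ (S.card : ℝ≥0∞)⁻¹ *
            ∑ p ∈ S, (ENNReal.ofReal (harmonic (S.filter fun q => ¬ p ≤ q).card : ℝ) + 1) := by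
            gcongr with p hp
            exact ih _ _ fun a ha b hb =>
              hSchain a (Finset.mem_of_mem_filter a ha) b (Finset.mem_of_mem_filter b hb)
        _ = ENNReal.ofReal (harmonic S.card : ℝ) := by
            rw [sum_card_filter_not_le S hSchain
                (fun j => ENNReal.ofReal (harmonic j : ℝ) + 1),
              sum_range_ofReal_harmonic_add_one, ← mul_assoc,
              ENNReal.inv_mul_cancel (by simpa using hS.ne_empty) (ENNReal.natCast_ne_top _),
              one_mul]
        _ ≤ _ := ENNReal.ofReal_le_ofReal
            (by exact_mod_cast harmonic_mono (Finset.card_le_card hSC))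
    · have h1 : (1 : ℚ) ≤ harmonic C.card := by
        simpa [harmonic] using harmonic_mono (Finset.one_le_card.2 hC)
      rw [PMF.tsum_pure_mul, Nat.cast_one, ENNReal.one_le_ofReal]
      exact_mod_cast h1
    · simp

theorem harmonic_le_two_mul_logb_add_one (m : ℕ) :
    (harmonic m : ℝ) ≤ 2 * Real.logb 2 (1 + (m : ℝ)) + 1 := by
  have hlog : Real.log m ≤ Real.log (1 + m) := by
    rcases m.eq_zero_or_pos with rfl | hm
    · simp
    · exact Real.log_le_log (by exact_mod_cast hm) (by linarith)
  have h0 : 0 ≤ Real.log (1 + (m : ℝ)) := Real.log_nonneg (by simp)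
  have h2 : Real.log 2 ≤ 1 := by linarith [Real.log_two_lt_d9]
  have hdiv : Real.log (1 + (m : ℝ)) ≤ Real.logb 2 (1 + (m : ℝ)) :=
    le_div_self h0 (Real.log_pos one_lt_two) h2
  linarith [harmonic_le_one_add_log m]

/-- On a chain `C` of `m ≥ 1` points, whatever strategy Bob uses, the expected
number of rounds of the attrition-and-elimination game is at most
`2·log₂(1 + m) + 1`. -/
theorem stmt6 {d : ℕ} (C : Finset (Fin d → ℝ)) (m : ℕ) (hm : 1 ≤ m)
    (hcard : C.card = m)
    (hchain : ∀ p ∈ C, ∀ q ∈ C, domEq p q ∨ domEq q p)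
    (strat : List (Finset (Fin d → ℝ) × (Fin d → ℝ)) → Finset (Fin d → ℝ) → Finset (Fin d → ℝ))
    (hstrat : ∀ hist D, strat hist D ⊆ D) :
    ∑' k : ℕ, (aeGame strat m C [] k) * (k : ℝ≥0∞)
      ≤ ENNReal.ofReal (2 * Real.logb 2 (1 + (m : ℝ)) + 1) := by
  subst hcard
  refine (expected_rounds_le_harmonic strat hstrat _ C [] fun p hp q hq => ?_).trans
    (ENNReal.ofReal_le_ofReal (harmonic_le_two_mul_logb_add_one _))
  simpa only [domEq_iff_le, or_comm] using hchain p hp q hq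
end
end
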